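/- Let n ≥ 0 be an integer and let B, C be integers. The ℚ-vector space of polynomials p ∈ ℚ[Y,Z] of total degree at most n satisfying p(B+i, C+j) = 0 for all integers i, j ≥ 0 with i + j < n has dimension n+1, and the polynomials [Y−B]_d·[Z−C]_{n−d} for d = 0, 1, …, n form a basis of this space. -/

import Mathlib

/-- The space of polynomials `p ∈ ℚ[Y,Z]` of total degree at most `n` with
`p(B+i, C+j) = 0` for all `i, j ≥ 0` with `i + j < n`. -/
noncomputable def vanishSpace (n : ℕ) (B C : ℤ) : Submodule ℚ (MvPolynomial (Fin 2) ℚ) :=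
  MvPolynomial.restrictTotalDegree (Fin 2) ℚ n ⊓
    ⨅ (i : ℕ) (j : ℕ) (_ : i + j < n),
      LinearMap.ker
        (MvPolynomial.aeval (R := ℚ) (S₁ := ℚ)
          ![(B : ℚ) + (i : ℚ), (C : ℚ) + (j : ℚ)]).toLinearMap

section

open MvPolynomial

/-- The product `[Y - b]_k * [Z - c]_l` of falling factorials. -/
noncomputable def fallingProd (b c : ℚ) (k l : ℕ) : MvPolynomial (Fin 2) ℚ :=
  Polynomial.aeval (X 0 - C b) (descPochhammer ℚ k) *
    Polynomial.aeval (X 1 - C c) (descPochhammer ℚ l)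

theorem aeval_descPochhammer_succ {A : Type*} [CommRing A] [Algebra ℚ A] (x : A) (k : ℕ) :
    Polynomial.aeval x (descPochhammer ℚ (k + 1)) =
      Polynomial.aeval x (descPochhammer ℚ k) * (x - k) := by
  simp [descPochhammer_succ_right]

theorem aeval_fallingProd (b c : ℚ) (k l i j : ℕ) :
    aeval (R := ℚ) (S₁ := ℚ) ![b + (i : ℚ), c + (j : ℚ)] (fallingProd b c k l) =
      (i.descFactorial k : ℚ) * (j.descFactorial l : ℚ) := by
  rw [fallingProd, map_mul, ← Polynomial.aeval_algHom_apply, ← Polynomial.aeval_algHom_apply]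
  simp [Polynomial.coe_aeval_eq_eval, descPochhammer_eval_eq_descFactorial]

theorem totalDegree_aeval_descPochhammer_le (s : Fin 2) (b : ℚ) (k : ℕ) :
    (Polynomial.aeval (X s - C b : MvPolynomial (Fin 2) ℚ) (descPochhammer ℚ k)).totalDegree
      ≤ k := by
  induction k with
  | zero => simp
  | succ k ih =>
    rw [aeval_descPochhammer_succ]
    refine (totalDegree_mul _ _).trans (add_le_add ih ?_)
    have h : (X s - C b - (k : MvPolynomial (Fin 2) ℚ)) = X s - C (b + k) := by
      simp [sub_sub]
    rw [h]
    exact (totalDegree_sub_C_le _ _).trans (totalDegree_X s).le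

theorem totalDegree_fallingProd_le (b c : ℚ) (k l : ℕ) :
    (fallingProd b c k l).totalDegree ≤ k + l :=
  (totalDegree_mul _ _).trans (add_le_add (totalDegree_aeval_descPochhammer_le 0 b k)
    (totalDegree_aeval_descPochhammer_le 1 c l))

theorem X_zero_mul_fallingProd (b c : ℚ) (k l : ℕ) :
    X 0 * fallingProd b c k l = fallingProd b c (k + 1) l + (b + k) • fallingProd b c k l := by
  simp only [fallingProd, aeval_descPochhammer_succ, smul_eq_C_mul, map_add, map_natCast]
  ring

theorem X_one_mul_fallingProd (b c : ℚ) (k l : ℕ) :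
    X 1 * fallingProd b c k l = fallingProd b c k (l + 1) + (c + l) • fallingProd b c k l := by
  simp only [fallingProd, aeval_descPochhammer_succ, smul_eq_C_mul, map_add, map_natCast]
  ring

/-- The span of the products of falling factorials of total degree at most `m`. -/
noncomputable def fallingSpan (b c : ℚ) (m : ℕ) : Submodule ℚ (MvPolynomial (Fin 2) ℚ) :=
  Submodule.span ℚ ((fun q : ℕ × ℕ => fallingProd b c q.1 q.2) '' {q | q.1 + q.2 ≤ m})

theorem fallingProd_mem_fallingSpan {b c : ℚ} {k l m : ℕ} (h : k + l ≤ m) :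
    fallingProd b c k l ∈ fallingSpan b c m :=
  Submodule.subset_span ⟨(k, l), h, rfl⟩

theorem X_mul_mem_fallingSpan {b c : ℚ} {m : ℕ} (s : Fin 2) {p : MvPolynomial (Fin 2) ℚ}
    (hp : p ∈ fallingSpan b c m) : X s * p ∈ fallingSpan b c (m + 1) := by
  induction hp using Submodule.span_induction with
  | mem x hx =>
    obtain ⟨⟨k, l⟩, h, rfl⟩ := hx
    simp only [Set.mem_ofPred_eq] at h
    fin_cases s
    · simp only [Fin.zero_eta, X_zero_mul_fallingProd]
      exact add_mem (fallingProd_mem_fallingSpan (by omega))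
        (Submodule.smul_mem _ _ (fallingProd_mem_fallingSpan (by omega)))
    · simp only [Fin.mk_one, X_one_mul_fallingProd]
      exact add_mem (fallingProd_mem_fallingSpan (by omega))
        (Submodule.smul_mem _ _ (fallingProd_mem_fallingSpan (by omega)))
  | zero => simp
  | add x y _ _ hx hy => rw [mul_add]; exact add_mem hx hy
  | smul a x _ hx => rw [mul_smul_comm]; exact Submodule.smul_mem _ _ hx

theorem fallingSpan_mono (b c : ℚ) : Monotone (fallingSpan b c) := fun _ _ h =>
  Submodule.span_mono (Set.image_mono fun _ hq => le_trans hq h)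

theorem X_pow_mul_mem_fallingSpan {b c : ℚ} {m : ℕ} (s : Fin 2) (k : ℕ)
    {p : MvPolynomial (Fin 2) ℚ} (hp : p ∈ fallingSpan b c m) :
    X s ^ k * p ∈ fallingSpan b c (m + k) := by
  induction k with
  | zero => simpa using hp
  | succ k ih =>
    rw [pow_succ', mul_assoc]
    exact X_mul_mem_fallingSpan s ih

theorem restrictTotalDegree_le_fallingSpan (b c : ℚ) (n : ℕ) :
    restrictTotalDegree (Fin 2) ℚ n ≤ fallingSpan b c n := by
  intro p hp
  rw [mem_restrictTotalDegree] at hp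
  rw [p.as_sum]
  refine Submodule.sum_mem _ fun e he => ?_
  have hdeg : e 1 + e 0 ≤ n := by
    have h := (le_totalDegree he).trans hp
    rwa [Finsupp.sum_fintype _ _ (fun _ => rfl), Fin.sum_univ_two, add_comm] at h
  have hone : (1 : MvPolynomial (Fin 2) ℚ) ∈ fallingSpan b c 0 := by
    have h := fallingProd_mem_fallingSpan (b := b) (c := c) (k := 0) (l := 0) le_rfl
    simpa [fallingProd] using h
  have h := X_pow_mul_mem_fallingSpan 0 (e 0) (X_pow_mul_mem_fallingSpan 1 (e 1) hone)
  rw [monomial_eq, Finsupp.prod_fintype _ _ (fun _ => pow_zero _), Fin.prod_univ_two,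
    ← smul_eq_C_mul]
  refine Submodule.smul_mem _ _ (fallingSpan_mono b c hdeg ?_)
  simpa using h

theorem mem_vanishSpace {n : ℕ} {B C : ℤ} {p : MvPolynomial (Fin 2) ℚ} :
    p ∈ vanishSpace n B C ↔ p.totalDegree ≤ n ∧ ∀ i j : ℕ, i + j < n →
      aeval (R := ℚ) (S₁ := ℚ) ![(B : ℚ) + (i : ℚ), (C : ℚ) + (j : ℚ)] p = 0 := by
  simp [vanishSpace, mem_restrictTotalDegree]

theorem fallingProd_mem_vanishSpace {n k l : ℕ} (B C : ℤ) (h : k + l = n) :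
    fallingProd B C k l ∈ vanishSpace n B C := by
  refine mem_vanishSpace.2 ⟨h ▸ totalDegree_fallingProd_le _ _ k l, fun i j hij => ?_⟩
  rw [aeval_fallingProd, mul_eq_zero, Nat.cast_eq_zero, Nat.cast_eq_zero,
    Nat.descFactorial_eq_zero_iff_lt, Nat.descFactorial_eq_zero_iff_lt]
  omega

theorem coeff_eq_zero_of_aeval_sum_fallingProd {n : ℕ} {b c : ℚ} {s : Finset (ℕ × ℕ)}
    {f : ℕ × ℕ → ℚ}
    (h : ∀ i j : ℕ, i + j < n → aeval (R := ℚ) (S₁ := ℚ) ![b + (i : ℚ), c + (j : ℚ)]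
      (∑ q ∈ s, f q • fallingProd b c q.1 q.2) = 0) :
    ∀ q ∈ s, q.1 + q.2 < n → f q = 0 := by
  suffices H : ∀ m, ∀ q ∈ s, q.1 + q.2 = m → q.1 + q.2 < n → f q = 0 from
    fun q hs hq => H _ q hs rfl hq
  intro m
  induction m using Nat.strong_induction_on with
  | _ m ih =>
    rintro ⟨i, j⟩ hs rfl hq
    have h0 := h i j hq
    simp only [map_sum, map_smul, aeval_fallingProd, smul_eq_mul] at h0
    rw [Finset.sum_eq_single_of_mem (i, j) hs] at h0
    · simpa [Nat.descFactorial_self, Nat.factorial_ne_zero] using h0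
    · rintro ⟨k, l⟩ hkl hne
      by_cases hlt : i < k ∨ j < l
      · rcases hlt with hlt | hlt <;> simp [Nat.descFactorial_of_lt hlt]
      · have hne' : ¬ (k = i ∧ l = j) := fun h => hne (by rw [h.1, h.2])
        rw [ih (k + l) (by dsimp only; omega) (k, l) hkl rfl (by dsimp only at hq ⊢; omega),
          zero_mul]

theorem linearIndependent_fallingProd (b c : ℚ) (n : ℕ) :
    LinearIndependent ℚ (fun d : Fin (n + 1) => fallingProd b c d (n - d)) := by
  rw [Fintype.linearIndependent_iff]
  intro g hg i
  have h0 := congrArg (aeval (R := ℚ) (S₁ := ℚ) ![b + ((i : ℕ) : ℚ), c + ((n - i : ℕ) : ℚ)]) hg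
  simp only [map_sum, map_smul, aeval_fallingProd, smul_eq_mul, map_zero] at h0
  rw [Finset.sum_eq_single_of_mem i (Finset.mem_univ i)] at h0
  · simpa [Nat.descFactorial_self, Nat.factorial_ne_zero] using h0
  · intro d _ hd
    have hd' : (d : ℕ) ≠ i := fun h => hd (Fin.ext h)
    have hlt : (i : ℕ) < d ∨ n - (i : ℕ) < n - d := by omega
    rcases hlt with hlt | hlt <;> simp [Nat.descFactorial_of_lt hlt]

theorem linearIndependent_rename_fallingProd (b c : ℚ) (n : ℕ) :
    LinearIndependent ℚ (fun d : Fin (n + 1) =>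
      Polynomial.aeval (X 0 - C b : MvPolynomial ℕ ℚ) (descPochhammer ℚ (d : ℕ)) *
        Polynomial.aeval (X 1 - C c) (descPochhammer ℚ (n - (d : ℕ)))) := by
  have h := (linearIndependent_fallingProd b c n).map'
    (rename (R := ℚ) (Fin.val : Fin 2 → ℕ)).toLinearMap
    (LinearMap.ker_eq_bot.2 (rename_injective _ Fin.val_injective))
  simpa [Function.comp_def, fallingProd, ← Polynomial.aeval_algHom_apply] using h

theorem span_fallingProd_eq_vanishSpace (n : ℕ) (B C : ℤ) :
    Submodule.span ℚ (Set.range fun d : Fin (n + 1) => fallingProd B C d (n - d)) =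
      vanishSpace n B C := by
  refine le_antisymm (Submodule.span_le.2 ?_) fun p hp => ?_
  · rintro _ ⟨d, rfl⟩
    exact fallingProd_mem_vanishSpace B C (by omega)
  · obtain ⟨hdeg, hvan⟩ := mem_vanishSpace.1 hp
    have hmem := restrictTotalDegree_le_fallingSpan B C n
      ((mem_restrictTotalDegree (Fin 2) n p).2 hdeg)
    obtain ⟨f, hf, rfl⟩ := (Finsupp.mem_span_image_iff_linearCombination ℚ).1 hmem
    rw [Finsupp.mem_supported] at hf
    rw [Finsupp.linearCombination_apply, Finsupp.sum] at hvan ⊢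
    refine Submodule.sum_mem _ fun q hq => Submodule.smul_mem _ _ (Submodule.subset_span ?_)
    have hle : q.1 + q.2 ≤ n := hf hq
    have hge : ¬ q.1 + q.2 < n := fun hlt =>
      Finsupp.mem_support_iff.1 hq (coeff_eq_zero_of_aeval_sum_fallingProd hvan q hq hlt)
    refine ⟨⟨q.1, by omega⟩, ?_⟩
    dsimp only
    congr 1
    omega

end

/-- For `n ≥ 0` and integers `B, C`, the space of polynomials `p ∈ ℚ[Y,Z]` of total
degree at most `n` with `p(B+i, C+j) = 0` for all `i,j ≥ 0`, `i+j < n` has dimension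
`n+1`, and the polynomials `[Y−B]_d·[Z−C]_{n−d}`, `d = 0, …, n`, form a basis of it. -/
theorem stmt11 (n : ℕ) (B C : ℤ) :
    Module.finrank ℚ (vanishSpace n B C) = n + 1 ∧
    LinearIndependent ℚ (fun d : Fin (n + 1) =>
      Polynomial.aeval (MvPolynomial.X 0 - MvPolynomial.C (B : ℚ))
          (descPochhammer ℚ (d : ℕ)) *
        Polynomial.aeval (MvPolynomial.X 1 - MvPolynomial.C (C : ℚ))
          (descPochhammer ℚ (n - (d : ℕ)))) ∧
    Submodule.span ℚ (Set.range (fun d : Fin (n + 1) =>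
        Polynomial.aeval (MvPolynomial.X 0 - MvPolynomial.C (B : ℚ))
            (descPochhammer ℚ (d : ℕ)) *
          Polynomial.aeval (MvPolynomial.X 1 - MvPolynomial.C (C : ℚ))
            (descPochhammer ℚ (n - (d : ℕ))))) = vanishSpace n B C := by
  have hli := linearIndependent_fallingProd (B : ℚ) (C : ℚ) n
  have hspan := span_fallingProd_eq_vanishSpace n B C
  refine ⟨?_, linearIndependent_rename_fallingProd B C n, hspan⟩
  rw [← hspan, finrank_span_eq_card hli, Fintype.card_fin]
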